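/- arXiv:2311.01558 — 2 statements merged into one kernel-verified Lean document; each statement's English description precedes it below -/
import Mathlib

section
/- (Cauchy–Schwarz step.) Let μ, ħ, a > 0, let Q : ℝ²×ℝ² → ℝ be continuous, symmetric and pointwise nonnegative, assume the kernel ħ𝓗₀ + Q is positive semidefinite on D_μ, and let g : ℝ² → [0,∞) be bounded and measurable with supp g ⊆ D_μ. Then for every n ≥ 1, every ε ∈ {±1}^n and every δ ∈ {±1}^{2n} having exactly n entries equal to +1, one has I_n(ε)² ≤ I_{2n}(δ) (as an inequality in [0,∞]). -/
open MeasureTheory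
open scoped ENNReal NNReal

noncomputable section

/-- The spacetime diamond `D_μ := {(t,s) : |t−s| < μ ∧ |t+s| < μ}`. -/
def diamond (μ : ℝ) : Set (ℝ × ℝ) := {z | |z.1 - z.2| < μ ∧ |z.1 + z.2| < μ}

/-- The absolute value of the Minkowskian square: `σ(z) := |t² − s²|`. -/
def mink (z : ℝ × ℝ) : ℝ := |z.1 ^ 2 - z.2 ^ 2|

/-- The real part of the massless Feynman propagator on two-dimensional Minkowski
spacetime at scale `μ`: `𝓗₀(z) := −(1/(4π)) log(σ(z)/(4μ²))` (junk value where `σ(z) = 0`). -/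
def H0 (μ : ℝ) (z : ℝ × ℝ) : ℝ := -(1 / (4 * Real.pi)) * Real.log (mink z / (4 * μ ^ 2))

/-- Signs `±1` encoded by booleans. -/
def sgn (b : Bool) : ℝ := if b then 1 else -1

/-- `C_Q := (sup_{(z,z') ∈ cl(D_μ)×cl(D_μ)} e^{a² Q(z,z')})^{1/2}`. -/
def CQ (a μ : ℝ) (Q : ℝ × ℝ → ℝ × ℝ → ℝ) : ℝ :=
  Real.sqrt (sSup ((fun p : (ℝ × ℝ) × (ℝ × ℝ) => Real.exp (a ^ 2 * Q p.1 p.2)) ''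
    (closure (diamond μ) ×ˢ closure (diamond μ))))

/-- The `L^q`-norm with respect to Lebesgue measure on `ℝ²`. -/
def LqNorm (q : ℝ) (g : ℝ × ℝ → ℝ) : ℝ := (∫ z : ℝ × ℝ, |g z| ^ q) ^ (1 / q)

/-- The kernel `hbar𝓗₀ + Q` is positive semidefinite on `D_μ`:
`∫∫ f(z) f(z') (hbar𝓗₀(z−z') + Q(z,z')) dz dz' ≥ 0` for all real `f ∈ C_c^∞(ℝ²)` with
`supp f ⊆ D_μ`. -/
def PosSemidefOn (μ hbar : ℝ) (Q : ℝ × ℝ → ℝ × ℝ → ℝ) : Prop :=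
  ∀ f : ℝ × ℝ → ℝ, ContDiff ℝ (⊤ : ℕ∞) f → HasCompactSupport f → tsupport f ⊆ diamond μ →
    0 ≤ ∫ z : ℝ × ℝ, ∫ z' : ℝ × ℝ, f z * f z' * (hbar * H0 μ (z - z') + Q z z')

/-- `I_k(δ) := ∫_{(ℝ²)^k} exp(−a² ∑_{i<j} δ_iδ_j (hbar𝓗₀(z_i−z_j) + Q(z_i,z_j))) ∏_i g(z_i)`,
valued in `[0,∞]`. -/
def Iint (a hbar μ : ℝ) (Q : ℝ × ℝ → ℝ × ℝ → ℝ) (g : ℝ × ℝ → ℝ) {k : ℕ}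
    (δ : Fin k → ℝ) : ℝ≥0∞ :=
  ∫⁻ z : Fin k → ℝ × ℝ, ENNReal.ofReal
    (Real.exp (-(a ^ 2) * ∑ i : Fin k, ∑ j : Fin k, if i < j then
        δ i * δ j * (hbar * H0 μ (z i - z j) + Q (z i) (z j)) else 0) *
      ∏ i : Fin k, g (z i))

open Set Filter Topology Metric

section QuadraticForm

variable {U : Set (ℝ × ℝ)} {K : (ℝ × ℝ) × (ℝ × ℝ) → ℝ}

/-- A kernel integrable on `U ×ˢ U` is integrable against bounded functions supported in `U`. -/
theorem integrable_mul_mul_kernel (hK : IntegrableOn K (U ×ˢ U))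
    {f h : ℝ × ℝ → ℝ} {M N : ℝ} (hf : Measurable f) (hh : Measurable h)
    (hfM : ∀ x, |f x| ≤ M) (hhN : ∀ x, |h x| ≤ N)
    (hfU : Function.support f ⊆ U) (hhU : Function.support h ⊆ U) :
    Integrable fun p : (ℝ × ℝ) × (ℝ × ℝ) => f p.1 * h p.2 * K p := by
  have hM : 0 ≤ M := (abs_nonneg _).trans (hfM 0)
  have h1 : IntegrableOn (fun p : (ℝ × ℝ) × (ℝ × ℝ) => f p.1 * h p.2 * K p) (U ×ˢ U) := by
    refine Integrable.bdd_mul (c := M * N) hK ?_ ?_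
    · exact ((hf.comp measurable_fst).mul (hh.comp measurable_snd)).aestronglyMeasurable
    · refine ae_of_all _ fun p => ?_
      rw [Real.norm_eq_abs, abs_mul]
      exact mul_le_mul (hfM _) (hhN _) (abs_nonneg _) hM
  refine (integrableOn_iff_integrable_of_support_subset ?_).1 h1
  intro p hp
  simp only [Function.mem_support, ne_eq, mul_eq_zero, not_or] at hp
  exact ⟨hfU hp.1.1, hhU hp.1.2⟩

/-- Nonnegativity of the quadratic form of an integrable kernel passes to bounded pointwise a.e.
limits. -/
theorem quadratic_form_nonneg_of_tendsto (hU : MeasurableSet U) (hK : IntegrableOn K (U ×ˢ U))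
    {f : ℝ × ℝ → ℝ} {F : ℕ → ℝ × ℝ → ℝ} {M : ℝ} (hF : ∀ k, Measurable (F k))
    (hFM : ∀ k x, |F k x| ≤ M) (hFU : ∀ᶠ k in atTop, Function.support (F k) ⊆ U)
    (hlim : ∀ᵐ x, Tendsto (fun k => F k x) atTop (𝓝 (f x)))
    (hpos : ∀ᶠ k in atTop, 0 ≤ ∫ p : (ℝ × ℝ) × (ℝ × ℝ), F k p.1 * F k p.2 * K p) :
    0 ≤ ∫ p : (ℝ × ℝ) × (ℝ × ℝ), f p.1 * f p.2 * K p := by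
  have hM : 0 ≤ M := (abs_nonneg _).trans (hFM 0 0)
  refine ge_of_tendsto (tendsto_integral_filter_of_dominated_convergence
    (fun p => indicator (U ×ˢ U) (fun p => M * M * |K p|) p) ?_ ?_ ?_ ?_) hpos
  · filter_upwards [hFU] with k hk
    exact (integrable_mul_mul_kernel hK (hF k) (hF k) (hFM k) (hFM k) hk hk).1
  · filter_upwards [hFU] with k hk
    refine ae_of_all _ fun p => ?_
    by_cases hp : p ∈ U ×ˢ U
    · rw [indicator_of_mem hp, Real.norm_eq_abs, abs_mul, abs_mul]
      gcongr
      · exact hFM k _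
      · exact hFM k _
    · rw [indicator_of_notMem hp]
      have : F k p.1 * F k p.2 = 0 := by
        by_contra hne
        rw [mul_eq_zero, not_or] at hne
        exact hp ⟨hk hne.1, hk hne.2⟩
      simp [this]
  · rw [integrable_indicator_iff (hU.prod hU)]
    exact hK.abs.const_mul _
  · have h1 := (Measure.quasiMeasurePreserving_fst (μ := (volume : Measure (ℝ × ℝ)))
      (ν := (volume : Measure (ℝ × ℝ)))).ae hlim
    have h2 := (Measure.quasiMeasurePreserving_snd (μ := (volume : Measure (ℝ × ℝ)))
      (ν := (volume : Measure (ℝ × ℝ)))).ae hlim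
    filter_upwards [h1, h2] with p hp1 hp2
    exact (hp1.mul hp2).mul_const _

open scoped Convolution in
/-- If the quadratic form of a locally integrable kernel is nonnegative on test functions, then it
is nonnegative on bounded measurable functions with support in a compact subset. -/
theorem quadratic_form_nonneg_of_support_subset_compact (hU : IsOpen U)
    (hK : IntegrableOn K (U ×ˢ U))
    (hpos : ∀ f : ℝ × ℝ → ℝ, ContDiff ℝ (⊤ : ℕ∞) f → HasCompactSupport f → tsupport f ⊆ U →
      0 ≤ ∫ p : (ℝ × ℝ) × (ℝ × ℝ), f p.1 * f p.2 * K p)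
    {f : ℝ × ℝ → ℝ} {M : ℝ} (hf : Measurable f) (hfM : ∀ x, |f x| ≤ M)
    {C : Set (ℝ × ℝ)} (hC : IsCompact C) (hCU : C ⊆ U) (hfC : Function.support f ⊆ C) :
    0 ≤ ∫ p : (ℝ × ℝ) × (ℝ × ℝ), f p.1 * f p.2 * K p := by
  have hfi : Integrable f := by
    refine (integrableOn_iff_integrable_of_support_subset hfC).1 ?_
    exact Measure.integrableOn_of_bounded (M := M) hC.measure_lt_top.ne hf.aestronglyMeasurable
      (ae_of_all _ hfM)
  have hrpos (k : ℕ) : (0 : ℝ) < 1 / ((k : ℝ) + 1) := by positivity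
  let φ : ℕ → ContDiffBump (0 : ℝ × ℝ) := fun k =>
    { rIn := 1 / ((k : ℝ) + 1)
      rOut := 2 * (1 / ((k : ℝ) + 1))
      rIn_pos := hrpos k
      rIn_lt_rOut := by linarith [hrpos k] }
  have hφ : Tendsto (fun k => (φ k).rOut) atTop (𝓝 0) := by
    have h := (tendsto_one_div_add_atTop_nhds_zero_nat (𝕜 := ℝ)).const_mul 2
    rwa [mul_zero] at h
  set F : ℕ → ℝ × ℝ → ℝ := fun k =>
    ((φ k).normed volume ⋆[ContinuousLinearMap.lsmul ℝ ℝ, volume] f) with hF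
  have hFsmooth (k : ℕ) : ContDiff ℝ (⊤ : ℕ∞) (F k) :=
    (φ k).hasCompactSupport_normed.contDiff_convolution_left _ (φ k).contDiff_normed
      hfi.locallyIntegrable
  have hFM (k : ℕ) (x : ℝ × ℝ) : |F k x| ≤ M := by
    rw [hF]
    simp only [convolution_def, ← Real.norm_eq_abs]
    refine (norm_integral_le_of_norm_le ((φ k).integrable_normed.mul_const M) ?_).trans ?_
    · refine ae_of_all _ fun t => ?_
      simp only [ContinuousLinearMap.lsmul_apply, smul_eq_mul, norm_mul, Real.norm_eq_abs,
        abs_of_nonneg ((φ k).nonneg_normed t)]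
      exact mul_le_mul_of_nonneg_left (hfM _) ((φ k).nonneg_normed t)
    · rw [integral_mul_const, (φ k).integral_normed, one_mul]
  obtain ⟨r, hr, hrU⟩ := hC.exists_cthickening_subset_open hU hCU
  have hsupp : ∀ᶠ k in atTop, tsupport (F k) ⊆ cthickening r C := by
    filter_upwards [hφ.eventually (gt_mem_nhds hr)] with k hk
    refine closure_minimal ?_ isClosed_cthickening
    refine (support_convolution_subset _).trans ?_
    rintro _ ⟨x, hx, y, hy, rfl⟩
    rw [(φ k).support_normed_eq, mem_ball_zero_iff] at hx
    refine mem_cthickening_of_dist_le (x + y) y r C (hfC hy) ?_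
    rw [dist_eq_norm]
    simpa using (hx.trans hk).le
  refine quadratic_form_nonneg_of_tendsto hU.measurableSet hK (F := F) (M := M)
    (fun k => (hFsmooth k).continuous.measurable) hFM ?_ ?_ ?_
  · filter_upwards [hsupp] with k hk using (subset_tsupport _).trans (hk.trans hrU)
  · exact ContDiffBump.ae_convolution_tendsto_right_of_locallyIntegrable (K := 2) hφ
      (Eventually.of_forall fun k => le_rfl) hfi.locallyIntegrable
  · filter_upwards [hsupp] with k hk
    exact hpos _ (hFsmooth k) (hC.cthickening.of_isClosed_subset (isClosed_tsupport _) hk)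
      (hk.trans hrU)

/-- If the quadratic form of an integrable kernel on a bounded open set is nonnegative on test
functions, then it is nonnegative on bounded measurable functions. -/
theorem quadratic_form_nonneg_of_support_subset (hU : IsOpen U) (hUb : Bornology.IsBounded U)
    (hK : IntegrableOn K (U ×ˢ U))
    (hpos : ∀ f : ℝ × ℝ → ℝ, ContDiff ℝ (⊤ : ℕ∞) f → HasCompactSupport f → tsupport f ⊆ U →
      0 ≤ ∫ p : (ℝ × ℝ) × (ℝ × ℝ), f p.1 * f p.2 * K p)
    {f : ℝ × ℝ → ℝ} {M : ℝ} (hf : Measurable f) (hfM : ∀ x, |f x| ≤ M)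
    (hfU : Function.support f ⊆ U) :
    0 ≤ ∫ p : (ℝ × ℝ) × (ℝ × ℝ), f p.1 * f p.2 * K p := by
  obtain ⟨C, hCcl, hCU, hCun, hCmono⟩ := hU.exists_iUnion_isClosed
  have hM : 0 ≤ M := (abs_nonneg _).trans (hfM 0)
  have hmeas (k : ℕ) : Measurable ((C k).indicator f) := hf.indicator (hCcl k).measurableSet
  have hbd (k : ℕ) (x : ℝ × ℝ) : |(C k).indicator f x| ≤ M := by
    by_cases hx : x ∈ C k
    · simpa [hx] using hfM x
    · simpa [hx] using hM
  refine quadratic_form_nonneg_of_tendsto hU.measurableSet hK (F := fun k => (C k).indicator f)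
    (M := M) hmeas hbd ?_ ?_ ?_
  · exact Eventually.of_forall fun k => support_indicator_subset.trans (hCU k)
  · refine ae_of_all _ fun x => ?_
    by_cases hx : x ∈ U
    · rw [← hCun, mem_iUnion] at hx
      obtain ⟨i, hi⟩ := hx
      refine tendsto_const_nhds.congr' ?_
      filter_upwards [eventually_ge_atTop i] with k hk
      rw [indicator_of_mem (hCmono hk hi)]
    · have hfx : f x = 0 := by
        by_contra h
        exact hx (hfU h)
      have h0 (k : ℕ) : (C k).indicator f x = 0 := by
        by_cases hk : x ∈ C k <;> simp [hk, hfx]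
      simp only [h0, hfx, tendsto_const_nhds]
  · refine Eventually.of_forall fun k => ?_
    exact quadratic_form_nonneg_of_support_subset_compact hU hK hpos (hmeas k) (hbd k)
      (isCompact_of_isClosed_isBounded (hCcl k) (hUb.subset (hCU k))) (hCU k)
      support_indicator_subset

end QuadraticForm

section Kernel

theorem isOpen_diamond (μ : ℝ) : IsOpen (diamond μ) :=
  (isOpen_lt (continuous_fst.sub continuous_snd).abs continuous_const).inter
    (isOpen_lt (continuous_fst.add continuous_snd).abs continuous_const)

theorem diamond_subset_Icc_prod_Icc (μ : ℝ) : diamond μ ⊆ Icc (-μ) μ ×ˢ Icc (-μ) μ := by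
  rintro ⟨t, s⟩ ⟨h1, h2⟩
  rw [abs_lt] at h1 h2
  simp only [mem_prod, mem_Icc] at *
  refine ⟨⟨?_, ?_⟩, ?_, ?_⟩ <;> linarith

theorem isBounded_diamond (μ : ℝ) : Bornology.IsBounded (diamond μ) :=
  (isCompact_Icc.prod isCompact_Icc).isBounded.subset (diamond_subset_Icc_prod_Icc μ)

theorem setLIntegral_enorm_log_add_le {μ c : ℝ} (hc : |c| ≤ 3 * μ) :
    ∫⁻ s in Icc (-μ) μ, ‖Real.log (s + c)‖ₑ ≤ ∫⁻ x in Icc (-(4 * μ)) (4 * μ), ‖Real.log x‖ₑ := by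
  rw [← lintegral_indicator measurableSet_Icc, ← lintegral_indicator measurableSet_Icc,
    ← lintegral_add_right_eq_self (indicator (Icc (-(4 * μ)) (4 * μ)) fun x => ‖Real.log x‖ₑ) c]
  refine lintegral_mono fun s => ?_
  by_cases hs : s ∈ Icc (-μ) μ
  swap
  · simp only [indicator_of_notMem hs, zero_le]
  rw [indicator_of_mem hs, indicator_of_mem]
  rw [abs_le] at hc
  constructor <;> linarith [hs.1, hs.2]

/-- `log |s + c|` is integrable in `(x, s)` on a bounded box, when the shift `c` depends
measurably on `x` in a set of finite measure and is bounded there. -/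
theorem integrableOn_log_add {X : Type*} [MeasurableSpace X] {ν : Measure X} [SFinite ν]
    {S : Set X} (hS : MeasurableSet S) (hν : ν S ≠ ∞) {c : X → ℝ} (hc : Measurable c) {μ : ℝ}
    (hcb : ∀ x ∈ S, |c x| ≤ 3 * μ) :
    IntegrableOn (fun p : X × ℝ => Real.log (p.2 + c p.1)) (S ×ˢ Icc (-μ) μ)
      (ν.prod volume) := by
  have hmeas : Measurable fun p : X × ℝ => Real.log (p.2 + c p.1) :=
    Real.measurable_log.comp (measurable_snd.add (hc.comp measurable_fst))
  have hlog : ∫⁻ x in Icc (-(4 * μ)) (4 * μ), ‖Real.log x‖ₑ < ∞ := by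
    have h : IntegrableOn Real.log (Icc (-(4 * μ)) (4 * μ)) := by
      rcases le_or_gt (-(4 * μ)) (4 * μ) with h | h
      · exact (intervalIntegrable_iff_integrableOn_Icc_of_le h).1
          intervalIntegral.intervalIntegrable_log'
      · simp [Icc_eq_empty_of_lt h]
    exact h.2
  refine ⟨hmeas.aestronglyMeasurable, ?_⟩
  rw [hasFiniteIntegral_iff_enorm, ← Measure.prod_restrict, lintegral_prod _ (by fun_prop)]
  calc ∫⁻ x in S, ∫⁻ s in Icc (-μ) μ, ‖Real.log (s + c x)‖ₑ ∂volume ∂ν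
      ≤ ∫⁻ x in S, ∫⁻ x in Icc (-(4 * μ)) (4 * μ), ‖Real.log x‖ₑ ∂volume ∂ν :=
        setLIntegral_mono' hS fun x hx => setLIntegral_enorm_log_add_le (hcb x hx)
    _ = (∫⁻ x in Icc (-(4 * μ)) (4 * μ), ‖Real.log x‖ₑ) * ν S := setLIntegral_const _ _
    _ < ∞ := ENNReal.mul_lt_top hlog hν.lt_top

theorem integrableOn_log_add_box {μ : ℝ} {c : (ℝ × ℝ) × ℝ → ℝ} (hc : Measurable c)
    (hcb : ∀ x ∈ (Icc (-μ) μ ×ˢ Icc (-μ) μ) ×ˢ Icc (-μ) μ, |c x| ≤ 3 * μ) :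
    IntegrableOn (fun p : (ℝ × ℝ) × (ℝ × ℝ) => Real.log (p.2.2 + c (p.1, p.2.1)))
      ((Icc (-μ) μ ×ˢ Icc (-μ) μ) ×ˢ (Icc (-μ) μ ×ˢ Icc (-μ) μ)) := by
  have hfin : (volume : Measure ((ℝ × ℝ) × ℝ)) ((Icc (-μ) μ ×ˢ Icc (-μ) μ) ×ˢ Icc (-μ) μ) ≠ ∞ :=
    ((isCompact_Icc.prod isCompact_Icc).prod isCompact_Icc).measure_lt_top.ne
  have h := integrableOn_log_add (ν := (volume : Measure ((ℝ × ℝ) × ℝ)))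
    ((measurableSet_Icc.prod measurableSet_Icc).prod measurableSet_Icc) hfin hc hcb
  have hmp := (volume_preserving_prodAssoc (α₁ := ℝ × ℝ) (β₁ := ℝ) (γ₁ := ℝ)).symm
  refine (hmp.integrableOn_comp_preimage
    (MeasurableEquiv.prodAssoc (α := ℝ × ℝ) (β := ℝ) (γ := ℝ)).symm.measurableEmbedding).2
    h |>.mono_set fun p hp => ⟨⟨hp.1, hp.2.1⟩, hp.2.2⟩

theorem measurable_H0 (μ : ℝ) : Measurable (H0 μ) := by
  unfold H0 mink
  fun_prop

theorem H0_neg (μ : ℝ) (z : ℝ × ℝ) : H0 μ (-z) = H0 μ z := by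
  simp [H0, mink]

theorem abs_H0_le (μ : ℝ) (z : ℝ × ℝ) :
    |H0 μ z| ≤ 1 / (4 * Real.pi) *
      (|Real.log (z.1 - z.2)| + |Real.log (z.1 + z.2)| + |Real.log (4 * μ ^ 2)|) := by
  rw [H0, abs_mul, abs_neg, abs_of_nonneg (by positivity : 0 ≤ 1 / (4 * Real.pi))]
  refine mul_le_mul_of_nonneg_left ?_ (by positivity)
  have h : mink z = |(z.1 - z.2) * (z.1 + z.2)| := by
    rw [mink]
    congr 1
    ring
  by_cases h0 : mink z / (4 * μ ^ 2) = 0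
  · rw [h0, Real.log_zero, abs_zero]
    positivity
  · rw [div_eq_zero_iff, not_or, h, abs_eq_zero, mul_eq_zero, not_or] at h0
    rw [h, Real.log_div (abs_ne_zero.2 (mul_ne_zero h0.1.1 h0.1.2)) h0.2, Real.log_abs,
      Real.log_mul h0.1.1 h0.1.2]
    exact (abs_sub _ _).trans (add_le_add_left (abs_add_le _ _) _)

theorem integrableOn_H0_sub (μ : ℝ) :
    IntegrableOn (fun p : (ℝ × ℝ) × (ℝ × ℝ) => H0 μ (p.1 - p.2)) (diamond μ ×ˢ diamond μ) := by
  refine IntegrableOn.mono_set ?_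
    (prod_mono (diamond_subset_Icc_prod_Icc μ) (diamond_subset_Icc_prod_Icc μ))
  have h1 := integrableOn_log_add_box (μ := μ) (c := fun x => x.1.1 - x.2 - x.1.2)
    (by fun_prop) (by
      rintro ⟨⟨t, s⟩, t'⟩ ⟨⟨⟨h1, h2⟩, h3, h4⟩, h5, h6⟩
      simp only at *
      rw [abs_le]
      constructor <;> linarith)
  have h2 := integrableOn_log_add_box (μ := μ) (c := fun x => x.2 - x.1.1 - x.1.2)
    (by fun_prop) (by
      rintro ⟨⟨t, s⟩, t'⟩ ⟨⟨⟨h1, h2⟩, h3, h4⟩, h5, h6⟩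
      simp only at *
      rw [abs_le]
      constructor <;> linarith)
  have h3 : IntegrableOn (fun _ : (ℝ × ℝ) × (ℝ × ℝ) => |Real.log (4 * μ ^ 2)|)
      ((Icc (-μ) μ ×ˢ Icc (-μ) μ) ×ˢ (Icc (-μ) μ ×ˢ Icc (-μ) μ)) :=
    integrableOn_const ((isCompact_Icc.prod isCompact_Icc).prod
      (isCompact_Icc.prod isCompact_Icc)).measure_lt_top.ne
  refine (((h1.abs.add h2.abs).add h3).const_mul (1 / (4 * Real.pi))).mono' ?_ ?_
  · exact ((measurable_H0 μ).comp (measurable_fst.sub measurable_snd)).aestronglyMeasurable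
  · refine ae_of_all _ fun p => (abs_H0_le μ _).trans_eq ?_
    have e1 : p.2.2 + (p.2.1 - p.1.1 - p.1.2) = -((p.1 - p.2).1 + (p.1 - p.2).2) := by
      simp only [Prod.fst_sub, Prod.snd_sub]
      ring
    have e2 : p.2.2 + (p.1.1 - p.2.1 - p.1.2)
        = (p.1 - p.2).1 - (p.1 - p.2).2 := by
      simp only [Prod.fst_sub, Prod.snd_sub]
      ring
    simp only [Pi.add_apply, e1, e2, Real.log_neg_eq_log]

theorem integrableOn_kernel (μ hbar : ℝ) {Q : ℝ × ℝ → ℝ × ℝ → ℝ}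
    (hQc : Continuous fun z : (ℝ × ℝ) × (ℝ × ℝ) => Q z.1 z.2) :
    IntegrableOn (fun p : (ℝ × ℝ) × (ℝ × ℝ) => hbar * H0 μ (p.1 - p.2) + Q p.1 p.2)
      (diamond μ ×ˢ diamond μ) := by
  refine ((integrableOn_H0_sub μ).const_mul hbar).add ?_
  refine IntegrableOn.mono_set ?_
    (prod_mono (diamond_subset_Icc_prod_Icc μ) (diamond_subset_Icc_prod_Icc μ))
  exact hQc.continuousOn.integrableOn_compact
    ((isCompact_Icc.prod isCompact_Icc).prod (isCompact_Icc.prod isCompact_Icc))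

/-- The positivity hypothesis extends from test functions to bounded measurable functions. -/
theorem PosSemidefOn.quadratic_form_nonneg {μ hbar : ℝ} {Q : ℝ × ℝ → ℝ × ℝ → ℝ}
    (hpsd : PosSemidefOn μ hbar Q)
    (hQc : Continuous fun z : (ℝ × ℝ) × (ℝ × ℝ) => Q z.1 z.2)
    {f : ℝ × ℝ → ℝ} {M : ℝ} (hf : Measurable f) (hfM : ∀ x, |f x| ≤ M)
    (hfU : Function.support f ⊆ diamond μ) :
    0 ≤ ∫ p : (ℝ × ℝ) × (ℝ × ℝ),
      f p.1 * f p.2 * (hbar * H0 μ (p.1 - p.2) + Q p.1 p.2) := by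
  have hK := integrableOn_kernel μ hbar hQc
  refine quadratic_form_nonneg_of_support_subset (isOpen_diamond μ) (isBounded_diamond μ) hK
    (fun φ hφ hφc hφU => ?_) hf hfM hfU
  obtain ⟨N, hN⟩ := hφc.exists_bound_of_continuous hφ.continuous
  have hsupp := (subset_tsupport φ).trans hφU
  rw [Measure.volume_eq_prod, integral_prod _ (integrable_mul_mul_kernel hK
    hφ.continuous.measurable hφ.continuous.measurable hN hN hsupp hsupp)]
  exact hpsd φ hφ hφc hφU

end Kernel

section Jensen

/-- The integral of a real function is at most the lower Lebesgue integral of its positive part. -/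
theorem ofReal_integral_le_lintegral_ofReal {X : Type*} [MeasurableSpace X] {m : Measure X}
    {h : X → ℝ} (hh : Integrable h m) :
    ENNReal.ofReal (∫ x, h x ∂m) ≤ ∫⁻ x, ENNReal.ofReal (h x) ∂m := by
  rw [integral_eq_lintegral_pos_part_sub_lintegral_neg_part hh]
  refine (ENNReal.ofReal_le_ofReal (sub_le_self _ ENNReal.toReal_nonneg)).trans ?_
  exact ENNReal.ofReal_toReal_le

/-- The exponential of a function with nonnegative integral has integral at least the total
mass. -/
theorem measure_univ_le_lintegral_exp {X : Type*} [MeasurableSpace X] {m : Measure X}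
    [IsFiniteMeasure m] {h : X → ℝ} (hh : Integrable h m) (h0 : 0 ≤ ∫ x, h x ∂m) :
    m univ ≤ ∫⁻ x, ENNReal.ofReal (Real.exp (h x)) ∂m := by
  calc m univ = ENNReal.ofReal (m.real univ) := (ofReal_measureReal).symm
    _ ≤ ENNReal.ofReal (∫ x, (h x + 1) ∂m) := by
        refine ENNReal.ofReal_le_ofReal ?_
        rw [integral_add hh (integrable_const _), integral_const, smul_eq_mul, mul_one]
        exact le_add_of_nonneg_left h0
    _ ≤ ∫⁻ x, ENNReal.ofReal (h x + 1) ∂m :=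
        ofReal_integral_le_lintegral_ofReal (hh.add (integrable_const _))
    _ ≤ ∫⁻ x, ENNReal.ofReal (Real.exp (h x)) ∂m :=
        lintegral_mono fun x => ENNReal.ofReal_le_ofReal (Real.add_one_le_exp _)

variable {ι : Type*} [Fintype ι] {U : Set (ℝ × ℝ)}

/-- The one-particle marginals of a bounded density supported in `U^ι` have bounded densities
supported in `U`. -/
theorem exists_bounded_density_map_eval (hU : MeasurableSet U) (hUfin : volume U ≠ ∞)
    {F : (ι → ℝ × ℝ) → ℝ≥0} {N : ℝ≥0} (hFN : ∀ z, F z ≤ N)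
    (hFU : Function.support F ⊆ univ.pi fun _ => U) (i : ι) :
    ∃ f : ℝ × ℝ → ℝ≥0, Measurable f ∧ (∃ C, ∀ x, f x ≤ C) ∧ Function.support f ⊆ U ∧
      Measure.map (fun z => z i) (volume.withDensity fun z => (F z : ℝ≥0∞)) =
        volume.withDensity fun x => (f x : ℝ≥0∞) := by
  classical
  set ν := volume.withDensity fun z => (F z : ℝ≥0∞)
  set C : ℝ≥0∞ := N * ∏ _j ∈ Finset.univ \ {i}, volume U with hC
  have hCtop : C ≠ ∞ :=
    ENNReal.mul_ne_top ENNReal.coe_ne_top (ENNReal.prod_ne_top fun _ _ => hUfin)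
  have hbound (A : Set (ℝ × ℝ)) (hA : MeasurableSet A) :
      Measure.map (fun z => z i) ν A ≤ ∫⁻ x in A, U.indicator (fun _ => C) x := by
    have hAm : MeasurableSet ((fun z : ι → ℝ × ℝ => z i) ⁻¹' A) := measurable_pi_apply i hA
    rw [Measure.map_apply (measurable_pi_apply i) hA, withDensity_apply _ hAm,
      ← lintegral_indicator hAm, lintegral_indicator_const hU, Measure.restrict_apply hU]
    calc ∫⁻ z, indicator ((fun z : ι → ℝ × ℝ => z i) ⁻¹' A) (fun z => (F z : ℝ≥0∞)) z
        ≤ ∫⁻ z, indicator (univ.pi (Function.update (fun _ => U) i (U ∩ A)))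
            (fun _ => (N : ℝ≥0∞)) z := by
          refine lintegral_mono fun z => ?_
          by_cases hz : z ∈ univ.pi (Function.update (fun _ => U) i (U ∩ A))
          · rw [indicator_of_mem hz]
            exact (indicator_le_self _ _ _).trans (ENNReal.coe_le_coe.2 (hFN z))
          · rw [indicator_of_notMem hz]
            refine (indicator_apply_eq_zero.2 fun hzA => ?_).le
            by_contra hne
            refine hz fun j _ => ?_
            have hzU := hFU (show F z ≠ 0 by simpa using hne)
            by_cases hj : j = i
            · subst hj
              rw [Function.update_self]
              exact ⟨hzU j trivial, hzA⟩
            · rw [Function.update_of_ne hj]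
              exact hzU j trivial
      _ = C * volume (U ∩ A) := by
          rw [lintegral_indicator_const, volume_pi_pi]
          · have : (fun j => volume (Function.update (fun _ : ι => U) i (U ∩ A) j)) =
                Function.update (fun _ => volume U) i (volume (U ∩ A)) := by
              ext j
              by_cases hj : j = i
              · subst hj
                simp
              · simp [hj]
            rw [this, Finset.prod_update_of_mem (Finset.mem_univ i), hC]
            ring
          · refine MeasurableSet.univ_pi fun j => ?_
            by_cases hj : j = i
            · subst hj
              simpa using hU.inter ‹_›
            · simpa [hj] using hU
  have hle : Measure.map (fun z => z i) ν ≤ C • volume.restrict U := by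
    refine Measure.le_iff.2 fun A hA => (hbound A hA).trans_eq ?_
    rw [lintegral_indicator_const hU, Measure.restrict_apply hU, Measure.smul_apply,
      Measure.restrict_apply hA, inter_comm, smul_eq_mul]
  have hfin : IsFiniteMeasure (Measure.map (fun z => z i) ν) := by
    refine ⟨(hle univ).trans_lt ?_⟩
    rw [Measure.smul_apply, Measure.restrict_apply_univ, smul_eq_mul]
    exact ENNReal.mul_lt_top hCtop.lt_top hUfin.lt_top
  have hac : Measure.map (fun z => z i) ν ≪ volume :=
    (Measure.absolutelyContinuous_of_le hle).trans
      ((Measure.smul_absolutelyContinuous).trans Measure.restrict_le_self.absolutelyContinuous)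
  set ρ := (Measure.map (fun z => z i) ν).rnDeriv volume
  have hρ : volume.withDensity ρ = Measure.map (fun z => z i) ν :=
    Measure.withDensity_rnDeriv_eq _ _ hac
  have hρm : Measurable ρ := Measure.measurable_rnDeriv _ _
  have hρle : ρ ≤ᵐ[volume] U.indicator fun _ => C := by
    refine ae_le_of_forall_setLIntegral_le_of_sigmaFinite hρm fun A hA _ => ?_
    rw [← withDensity_apply _ hA, hρ]
    exact hbound A hA
  have hmin (x : ℝ × ℝ) : min (ρ x) (U.indicator (fun _ => C) x) ≤ C :=
    (min_le_right _ _).trans (indicator_le_self _ _ _)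
  refine ⟨fun x => (min (ρ x) (U.indicator (fun _ => C) x)).toNNReal,
    (hρm.min (measurable_const.indicator hU)).ennreal_toNNReal,
    ⟨C.toNNReal, fun x => ENNReal.toNNReal_mono hCtop (hmin x)⟩, ?_, ?_⟩
  · intro x hx
    by_contra hxU
    simp [hxU] at hx
  · rw [← hρ]
    refine withDensity_congr_ae ?_
    filter_upwards [hρle] with x hx
    rw [ENNReal.coe_toNNReal (ne_top_of_le_ne_top hCtop (hmin x)), min_eq_left hx]

/-- Let the kernel `K` have nonnegative quadratic form on `U`. Then the total mass of a bounded
density on `U^ι` satisfies a Jensen-type bound against the exponential of the form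
`∑ ε_i ε_j K(z_i, w_j)`. -/
theorem sq_lintegral_le_of_quadratic_form_nonneg (hU : MeasurableSet U) (hUfin : volume U ≠ ∞)
    {K : (ℝ × ℝ) × (ℝ × ℝ) → ℝ} (hKm : Measurable K) (hK : IntegrableOn K (U ×ˢ U))
    (hpos : ∀ (f : ℝ × ℝ → ℝ) (M : ℝ), Measurable f → (∀ x, |f x| ≤ M) →
      Function.support f ⊆ U → 0 ≤ ∫ p : (ℝ × ℝ) × (ℝ × ℝ), f p.1 * f p.2 * K p)
    {F : (ι → ℝ × ℝ) → ℝ≥0} (hF : Measurable F) {N : ℝ≥0} (hFN : ∀ z, F z ≤ N)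
    (hFU : Function.support F ⊆ univ.pi fun _ => U) (ε : ι → ℝ) {c : ℝ} (hc : 0 ≤ c) :
    (∫⁻ z, (F z : ℝ≥0∞)) ^ 2 ≤
      ∫⁻ p : (ι → ℝ × ℝ) × (ι → ℝ × ℝ), (F p.1 : ℝ≥0∞) * F p.2 *
        ENNReal.ofReal (Real.exp (c * ∑ i, ∑ j, ε i * ε j * K (p.1 i, p.2 j))) := by
  set ν := volume.withDensity fun z => (F z : ℝ≥0∞) with hν
  have hFm : Measurable fun z => (F z : ℝ≥0∞) := hF.coe_nnreal_ennreal
  have hνfin : IsFiniteMeasure ν := by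
    refine isFiniteMeasure_withDensity (ne_of_lt ?_)
    calc ∫⁻ z, (F z : ℝ≥0∞)
        ≤ ∫⁻ z, indicator (univ.pi fun _ : ι => U) (fun _ => (N : ℝ≥0∞)) z := by
          refine lintegral_mono fun z => ?_
          by_cases hz : z ∈ univ.pi fun _ : ι => U
          · rw [indicator_of_mem hz]
            exact ENNReal.coe_le_coe.2 (hFN z)
          · have : F z = 0 := by
              by_contra h
              exact hz (hFU h)
            simp [this]
      _ < ∞ := by
          rw [lintegral_indicator_const (MeasurableSet.univ_pi fun _ => hU), volume_pi_pi]
          exact ENNReal.mul_lt_top ENNReal.coe_lt_top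
            (ENNReal.prod_ne_top fun _ _ => hUfin).lt_top
  choose f hfm hfC hfU hfν using exists_bounded_density_map_eval (F := F) hU hUfin hFN hFU
  choose C hC using hfC
  have hprod (i j : ι) : Measure.map (Prod.map (fun z : ι → ℝ × ℝ => z i)
      (fun z : ι → ℝ × ℝ => z j)) (ν.prod ν) =
      volume.withDensity fun p : (ℝ × ℝ) × (ℝ × ℝ) => ((f i p.1 * f j p.2 : ℝ≥0) : ℝ≥0∞) := by
    rw [← Measure.map_prod_map _ _ (measurable_pi_apply i) (measurable_pi_apply j), hfν, hfν,
      prod_withDensity (hfm i).coe_nnreal_ennreal (hfm j).coe_nnreal_ennreal,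
      ← Measure.volume_eq_prod]
    simp only [ENNReal.coe_mul]
  have hmeas2 (i j : ι) : Measurable fun p : (ℝ × ℝ) × (ℝ × ℝ) => f i p.1 * f j p.2 :=
    ((hfm i).comp measurable_fst).mul ((hfm j).comp measurable_snd)
  have hfm' (i : ι) : Measurable fun x => (f i x : ℝ) := (hfm i).coe_nnreal_real
  have hfC' (i : ι) (x : ℝ × ℝ) : |(f i x : ℝ)| ≤ C i := by
    rw [NNReal.abs_eq]
    exact NNReal.coe_le_coe.2 (hC i x)
  have hfU' (i : ι) : (Function.support fun x => (f i x : ℝ)) ⊆ U := fun x hx =>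
    hfU i fun h => hx (by simp [h])
  have hev (i j : ι) : Measurable (Prod.map (fun z : ι → ℝ × ℝ => z i)
      (fun z : ι → ℝ × ℝ => z j)) := (measurable_pi_apply i).prodMap (measurable_pi_apply j)
  have hint (i j : ι) : Integrable (fun p : (ℝ × ℝ) × (ℝ × ℝ) => (f i p.1 : ℝ) * f j p.2 * K p) :=
    integrable_mul_mul_kernel hK (hfm' i) (hfm' j) (hfC' i) (hfC' j) (hfU' i) (hfU' j)
  have hKint (i j : ι) :
      Integrable (fun p : (ι → ℝ × ℝ) × (ι → ℝ × ℝ) => K (p.1 i, p.2 j)) (ν.prod ν) := by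
    have : Integrable K (Measure.map (Prod.map (fun z : ι → ℝ × ℝ => z i)
        (fun z : ι → ℝ × ℝ => z j)) (ν.prod ν)) := by
      rw [hprod, integrable_withDensity_iff_integrable_smul (hmeas2 i j)]
      simpa only [NNReal.smul_def, NNReal.coe_mul, smul_eq_mul] using hint i j
    exact this.comp_measurable (hev i j)
  have hKeq (i j : ι) : ∫ p : (ι → ℝ × ℝ) × (ι → ℝ × ℝ), K (p.1 i, p.2 j) ∂(ν.prod ν) =
      ∫ p : (ℝ × ℝ) × (ℝ × ℝ), (f i p.1 : ℝ) * f j p.2 * K p := by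
    have h := integral_map (hev i j).aemeasurable (μ := ν.prod ν) hKm.aestronglyMeasurable
    rw [hprod, integral_withDensity_eq_integral_smul (hmeas2 i j)] at h
    simp only [NNReal.smul_def, NNReal.coe_mul, smul_eq_mul] at h
    exact h.symm
  have hBint : Integrable (fun p : (ι → ℝ × ℝ) × (ι → ℝ × ℝ) =>
      c * ∑ i, ∑ j, ε i * ε j * K (p.1 i, p.2 j)) (ν.prod ν) :=
    (integrable_finsetSum _ fun i _ => integrable_finsetSum _ fun j _ =>
      (hKint i j).const_mul _).const_mul _
  have hBpos : 0 ≤ ∫ p : (ι → ℝ × ℝ) × (ι → ℝ × ℝ),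
      c * ∑ i, ∑ j, ε i * ε j * K (p.1 i, p.2 j) ∂(ν.prod ν) := by
    rw [integral_const_mul, integral_finsetSum _ fun i _ => integrable_finsetSum _ fun j _ =>
      (hKint i j).const_mul _]
    refine mul_nonneg hc ?_
    have hsum := hpos (fun x => ∑ i, ε i * f i x) (∑ i, |ε i| * C i)
      (Finset.measurable_sum _ fun i _ => (hfm' i).const_mul _)
      (fun x => (Finset.abs_sum_le_sum_abs _ _).trans (Finset.sum_le_sum fun i _ => by
        rw [abs_mul]
        exact mul_le_mul_of_nonneg_left (hfC' i x) (abs_nonneg _)))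
      (fun x hx => by
        obtain ⟨i, _, hi⟩ := Finset.exists_ne_zero_of_sum_ne_zero hx
        exact hfU' i (right_ne_zero_of_mul hi))
    refine hsum.trans_eq ?_
    calc ∫ p : (ℝ × ℝ) × (ℝ × ℝ), (∑ i, ε i * (f i p.1 : ℝ)) * (∑ i, ε i * (f i p.2 : ℝ)) * K p
        = ∫ p : (ℝ × ℝ) × (ℝ × ℝ),
            ∑ i, ∑ j, ε i * ε j * ((f i p.1 : ℝ) * f j p.2 * K p) := by
          congr 1 with p
          rw [Finset.sum_mul_sum, Finset.sum_mul]
          refine Finset.sum_congr rfl fun i _ => ?_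
          rw [Finset.sum_mul]
          exact Finset.sum_congr rfl fun j _ => by ring
      _ = ∑ i, ∑ j, ε i * ε j * ∫ p : (ℝ × ℝ) × (ℝ × ℝ), (f i p.1 : ℝ) * f j p.2 * K p := by
          rw [integral_finsetSum _ fun i _ => integrable_finsetSum _ fun j _ =>
            (hint i j).const_mul _]
          refine Finset.sum_congr rfl fun i _ => ?_
          rw [integral_finsetSum _ fun j _ => (hint i j).const_mul _]
          exact Finset.sum_congr rfl fun j _ => integral_const_mul _ _
      _ = _ := by
          refine Finset.sum_congr rfl fun i _ => ?_
          rw [integral_finsetSum _ fun j _ => (hKint i j).const_mul _]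
          refine Finset.sum_congr rfl fun j _ => ?_
          rw [integral_const_mul, hKeq]
  have hmain := measure_univ_le_lintegral_exp hBint hBpos
  have hmass : (ν.prod ν) univ = (∫⁻ z, (F z : ℝ≥0∞)) ^ 2 := by
    rw [← univ_prod_univ, Measure.prod_prod, hν, withDensity_apply _ MeasurableSet.univ,
      Measure.restrict_univ, sq]
  have hBm : Measurable fun p : (ι → ℝ × ℝ) × (ι → ℝ × ℝ) =>
      ENNReal.ofReal (Real.exp (c * ∑ i, ∑ j, ε i * ε j * K (p.1 i, p.2 j))) := by
    fun_prop
  have hFF : Measurable fun p : (ι → ℝ × ℝ) × (ι → ℝ × ℝ) => (F p.1 : ℝ≥0∞) * F p.2 :=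
    (hFm.comp measurable_fst).mul (hFm.comp measurable_snd)
  rw [hmass, hν, prod_withDensity hFm hFm,
    lintegral_withDensity_eq_lintegral_mul _ hFF hBm] at hmain
  exact hmain

/-- The bound of `sq_lintegral_le_of_quadratic_form_nonneg` without boundedness of the density. -/
theorem sq_lintegral_le_of_quadratic_form_nonneg_of_measurable (hU : MeasurableSet U)
    (hUfin : volume U ≠ ∞)
    {K : (ℝ × ℝ) × (ℝ × ℝ) → ℝ} (hKm : Measurable K) (hK : IntegrableOn K (U ×ˢ U))
    (hpos : ∀ (f : ℝ × ℝ → ℝ) (M : ℝ), Measurable f → (∀ x, |f x| ≤ M) →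
      Function.support f ⊆ U → 0 ≤ ∫ p : (ℝ × ℝ) × (ℝ × ℝ), f p.1 * f p.2 * K p)
    {F : (ι → ℝ × ℝ) → ℝ≥0} (hF : Measurable F)
    (hFU : Function.support F ⊆ univ.pi fun _ => U) (ε : ι → ℝ) {c : ℝ} (hc : 0 ≤ c) :
    (∫⁻ z, (F z : ℝ≥0∞)) ^ 2 ≤
      ∫⁻ p : (ι → ℝ × ℝ) × (ι → ℝ × ℝ), (F p.1 : ℝ≥0∞) * F p.2 *
        ENNReal.ofReal (Real.exp (c * ∑ i, ∑ j, ε i * ε j * K (p.1 i, p.2 j))) := by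
  have hlim : Tendsto (fun N : ℕ => ∫⁻ z, ((min (F z) N : ℝ≥0) : ℝ≥0∞)) atTop
      (𝓝 (∫⁻ z, (F z : ℝ≥0∞))) := by
    refine lintegral_tendsto_of_tendsto_of_monotone
      (fun N => ((hF.min measurable_const).coe_nnreal_ennreal).aemeasurable)
      (ae_of_all _ fun z N N' h => ?_) (ae_of_all _ fun z => ?_)
    · exact ENNReal.coe_le_coe.2 (min_le_min_left _ (Nat.cast_le.2 h))
    · refine tendsto_const_nhds.congr' ?_
      obtain ⟨m, hm⟩ := exists_nat_ge (F z)
      filter_upwards [eventually_ge_atTop m] with k hk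
      rw [min_eq_left (hm.trans (Nat.cast_le.2 hk))]
  refine le_of_tendsto' (ENNReal.Tendsto.pow (n := 2) hlim) fun N => ?_
  refine (sq_lintegral_le_of_quadratic_form_nonneg hU hUfin hKm hK hpos
    (F := fun z => min (F z) N) (hF.min measurable_const) (fun z => min_le_right _ _)
    (fun z hz => hFU fun h => hz (by simp [h])) ε hc).trans ?_
  refine lintegral_mono fun p => ?_
  gcongr
  · exact min_le_left _ _
  · exact min_le_left _ _

end Jensen

section Charges

variable {ι κ : Type*} [Fintype ι] [Fintype κ]

/-- Sign vectors with the same number of positive entries and the same number of entries agree up to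
a bijection of the index sets. -/
theorem exists_equiv_comp_eq_of_card_eq {δ : ι → ℝ} {η : κ → ℝ} (hδ : ∀ i, δ i = 1 ∨ δ i = -1)
    (hη : ∀ i, η i = 1 ∨ η i = -1) (hcard : Fintype.card ι = Fintype.card κ)
    (hpos : Fintype.card {i // δ i = 1} = Fintype.card {i // η i = 1}) :
    ∃ e : ι ≃ κ, η ∘ e = δ := by
  have hneg {x : ℝ} (hx : x = 1 ∨ x = -1) : x = -1 ↔ ¬ x = 1 := by
    rcases hx with h | h <;> norm_num [h]
  have key (c : ℝ) : Nonempty ({i // δ i = c} ≃ {i // η i = c}) := by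
    by_cases h1 : c = 1
    · subst h1
      exact ⟨Fintype.equivOfCardEq hpos⟩
    by_cases h2 : c = -1
    · subst h2
      refine ⟨Fintype.equivOfCardEq ?_⟩
      rw [Fintype.card_congr (Equiv.subtypeEquivRight fun i => hneg (hδ i)),
        Fintype.card_congr (Equiv.subtypeEquivRight fun i => hneg (hη i)), Fintype.card_subtype_compl,
        Fintype.card_subtype_compl, hcard, hpos]
    · have hδc : IsEmpty {i // δ i = c} :=
        ⟨fun i => (hδ i).elim (fun h => h1 (i.2.symm.trans h)) fun h => h2 (i.2.symm.trans h)⟩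
      have hηc : IsEmpty {i // η i = c} :=
        ⟨fun i => (hη i).elim (fun h => h1 (i.2.symm.trans h)) fun h => h2 (i.2.symm.trans h)⟩
      exact ⟨Equiv.equivOfIsEmpty _ _⟩
  refine ⟨Equiv.ofFiberEquiv fun c => (key c).some, ?_⟩
  ext1 i
  exact Equiv.ofFiberEquiv_map _ i

theorem card_sumElim_neg_eq_one {ε : ι → ℝ} (hε : ∀ i, ε i = 1 ∨ ε i = -1) :
    Fintype.card {i // Sum.elim ε (-ε) i = 1} = Fintype.card ι := by
  have h : ∀ i, (-ε) i = 1 ↔ ¬ ε i = 1 := by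
    intro i
    rcases hε i with h | h <;> norm_num [h]
  exact Fintype.card_congr (Equiv.subtypeSum.trans
    ((Equiv.sumCongr (Equiv.refl _) (Equiv.subtypeEquivRight h)).trans (Equiv.sumCompl _)))

variable [DecidableEq ι] [DecidableEq κ]

/-- Twice the interaction energy of charges `δ i` at the points `z i`: the sum over ordered pairs of
distinct indices. -/
def pairEnergy (K : ℝ × ℝ → ℝ × ℝ → ℝ) (δ : ι → ℝ) (z : ι → ℝ × ℝ) : ℝ :=
  ∑ i, ∑ j, if i = j then 0 else δ i * δ j * K (z i) (z j)

/-- The partition function of charges `δ` indexed by an arbitrary finite type. -/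
def chargeIntegral (c : ℝ) (K : ℝ × ℝ → ℝ × ℝ → ℝ) (g : ℝ × ℝ → ℝ) (δ : ι → ℝ) : ℝ≥0∞ :=
  ∫⁻ z : ι → ℝ × ℝ, ENNReal.ofReal
    (Real.exp (-c * (pairEnergy K δ z / 2)) * ∏ i, g (z i))

theorem sum_lt_eq_half_pairEnergy {n : ℕ} {K : ℝ × ℝ → ℝ × ℝ → ℝ} (hK : ∀ x y, K x y = K y x)
    (δ : Fin n → ℝ) (z : Fin n → ℝ × ℝ) :
    (∑ i : Fin n, ∑ j : Fin n, if i < j then δ i * δ j * K (z i) (z j) else 0) =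
      pairEnergy K δ z / 2 := by
  have hcomm : (∑ i : Fin n, ∑ j : Fin n, if i < j then δ i * δ j * K (z i) (z j) else 0) =
      ∑ i : Fin n, ∑ j : Fin n, if j < i then δ i * δ j * K (z i) (z j) else 0 := by
    rw [Finset.sum_comm]
    refine Finset.sum_congr rfl fun i _ => Finset.sum_congr rfl fun j _ => ?_
    rw [hK, mul_comm (δ j)]
  have hsplit : pairEnergy K δ z =
      (∑ i : Fin n, ∑ j : Fin n, if i < j then δ i * δ j * K (z i) (z j) else 0) +
      ∑ i : Fin n, ∑ j : Fin n, if j < i then δ i * δ j * K (z i) (z j) else 0 := by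
    simp only [pairEnergy, ← Finset.sum_add_distrib]
    refine Finset.sum_congr rfl fun i _ => Finset.sum_congr rfl fun j _ => ?_
    rcases lt_trichotomy i j with h | h | h
    · simp [h, h.ne, h.not_gt]
    · simp [h]
    · simp [h, h.ne', h.not_gt]
  rw [hsplit, ← hcomm]
  ring

theorem pairEnergy_comp_equiv (K : ℝ × ℝ → ℝ × ℝ → ℝ) (e : ι ≃ κ) (δ : κ → ℝ) (z : κ → ℝ × ℝ) :
    pairEnergy K (δ ∘ e) (z ∘ e) = pairEnergy K δ z := by
  unfold pairEnergy
  rw [← e.sum_comp]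
  refine Finset.sum_congr rfl fun i _ => ?_
  rw [← e.sum_comp]
  simp

theorem pairEnergy_sumElim_neg {K : ℝ × ℝ → ℝ × ℝ → ℝ} (hK : ∀ x y, K x y = K y x)
    (ε : ι → ℝ) (z w : ι → ℝ × ℝ) :
    pairEnergy K (Sum.elim ε (-ε)) (Sum.elim z w) =
      pairEnergy K ε z + pairEnergy K ε w - 2 * ∑ i, ∑ j, ε i * ε j * K (z i) (w j) := by
  have h : ∑ i, ∑ j, ε i * ε j * K (w i) (z j) = ∑ i, ∑ j, ε i * ε j * K (z i) (w j) := by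
    rw [Finset.sum_comm]
    refine Finset.sum_congr rfl fun i _ => Finset.sum_congr rfl fun j _ => ?_
    rw [hK, mul_comm (ε j)]
  simp only [pairEnergy, Fintype.sum_sum_type, Sum.elim_inl, Sum.elim_inr, Sum.inl.injEq,
    Sum.inr.injEq, reduceCtorEq, if_false, Pi.neg_apply, neg_mul, mul_neg, neg_neg,
    Finset.sum_neg_distrib, Finset.sum_add_distrib, h]
  ring

theorem chargeIntegral_comp_equiv (c : ℝ) (K : ℝ × ℝ → ℝ × ℝ → ℝ) (g : ℝ × ℝ → ℝ) (e : ι ≃ κ)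
    (δ : κ → ℝ) : chargeIntegral c K g (δ ∘ e) = chargeIntegral c K g δ := by
  have hmp := volume_measurePreserving_piCongrLeft (fun _ : κ => ℝ × ℝ) e
  unfold chargeIntegral
  rw [← hmp.lintegral_comp_emb (MeasurableEquiv.measurableEmbedding _)]
  refine lintegral_congr fun z => ?_
  have hz : (MeasurableEquiv.piCongrLeft (fun _ : κ => ℝ × ℝ) e z) ∘ e = z := by
    ext1 i
    exact Equiv.piCongrLeft_apply_apply (fun _ : κ => ℝ × ℝ) e z i
  rw [← pairEnergy_comp_equiv K e, hz, ← e.prod_comp]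
  simp only [← Function.comp_apply (f := MeasurableEquiv.piCongrLeft (fun _ : κ => ℝ × ℝ) e z), hz]

theorem chargeIntegral_sumElim_neg (c : ℝ) {K : ℝ × ℝ → ℝ × ℝ → ℝ} (hK : ∀ x y, K x y = K y x)
    {g : ℝ × ℝ → ℝ} (hg : ∀ x, 0 ≤ g x) (ε : ι → ℝ) :
    chargeIntegral c K g (Sum.elim ε (-ε)) =
      ∫⁻ p : (ι → ℝ × ℝ) × (ι → ℝ × ℝ),
        ENNReal.ofReal (Real.exp (-c * (pairEnergy K ε p.1 / 2)) * ∏ i, g (p.1 i)) *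
        ENNReal.ofReal (Real.exp (-c * (pairEnergy K ε p.2 / 2)) * ∏ i, g (p.2 i)) *
        ENNReal.ofReal (Real.exp (c * ∑ i, ∑ j, ε i * ε j * K (p.1 i) (p.2 j))) := by
  have hmp := volume_measurePreserving_sumPiEquivProdPi_symm (fun _ : ι ⊕ ι => ℝ × ℝ)
  unfold chargeIntegral
  rw [← hmp.lintegral_comp_emb (MeasurableEquiv.measurableEmbedding _)]
  refine lintegral_congr fun p => ?_
  have hp : (MeasurableEquiv.sumPiEquivProdPi (fun _ : ι ⊕ ι => ℝ × ℝ)).symm p =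
      Sum.elim p.1 p.2 := by
    ext1 i
    rcases i with i | i <;> rfl
  have hg' (z : ι → ℝ × ℝ) : 0 ≤ Real.exp (-c * (pairEnergy K ε z / 2)) * ∏ i, g (z i) :=
    mul_nonneg (Real.exp_pos _).le (Finset.prod_nonneg fun i _ => hg _)
  rw [hp, pairEnergy_sumElim_neg hK, Fintype.prod_sum_type, ← ENNReal.ofReal_mul (hg' _),
    ← ENNReal.ofReal_mul (mul_nonneg (hg' _) (hg' _))]
  congr 1
  have hexp : Real.exp (-c * ((pairEnergy K ε p.1 + pairEnergy K ε p.2 -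
      2 * ∑ i, ∑ j, ε i * ε j * K (p.1 i) (p.2 j)) / 2)) =
      Real.exp (-c * (pairEnergy K ε p.1 / 2)) * Real.exp (-c * (pairEnergy K ε p.2 / 2)) *
        Real.exp (c * ∑ i, ∑ j, ε i * ε j * K (p.1 i) (p.2 j)) := by
    rw [← Real.exp_add, ← Real.exp_add]
    congr 1
    ring
  rw [hexp]
  simp only [Sum.elim_inl, Sum.elim_inr]
  ring

theorem measurable_pairEnergy {K : ℝ × ℝ → ℝ × ℝ → ℝ}
    (hK : Measurable fun p : (ℝ × ℝ) × (ℝ × ℝ) => K p.1 p.2) (ε : ι → ℝ) :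
    Measurable fun z : ι → ℝ × ℝ => pairEnergy K ε z := by
  unfold pairEnergy
  refine Finset.measurable_sum _ fun i _ => Finset.measurable_sum _ fun j _ => ?_
  split_ifs
  · exact measurable_const
  · have hij : Measurable fun z : ι → ℝ × ℝ => (z i, z j) :=
      (measurable_pi_apply i).prodMk (measurable_pi_apply j)
    exact (hK.comp hij).const_mul _

/-- For a kernel with nonnegative quadratic form on `U`, doubling the system by opposite charges
dominates the square of the partition function. -/
theorem sq_chargeIntegral_le {U : Set (ℝ × ℝ)} (hU : MeasurableSet U) (hUfin : volume U ≠ ∞)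
    {K : ℝ × ℝ → ℝ × ℝ → ℝ} (hKsymm : ∀ x y, K x y = K y x)
    (hKm : Measurable fun p : (ℝ × ℝ) × (ℝ × ℝ) => K p.1 p.2)
    (hK : IntegrableOn (fun p : (ℝ × ℝ) × (ℝ × ℝ) => K p.1 p.2) (U ×ˢ U))
    (hpos : ∀ (f : ℝ × ℝ → ℝ) (M : ℝ), Measurable f → (∀ x, |f x| ≤ M) →
      Function.support f ⊆ U → 0 ≤ ∫ p : (ℝ × ℝ) × (ℝ × ℝ), f p.1 * f p.2 * K p.1 p.2)
    {g : ℝ × ℝ → ℝ} (hg0 : ∀ x, 0 ≤ g x) (hgm : Measurable g) (hgU : Function.support g ⊆ U)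
    (ε : ι → ℝ) {c : ℝ} (hc : 0 ≤ c) :
    chargeIntegral c K g ε ^ 2 ≤ chargeIntegral c K g (Sum.elim ε (-ε)) := by
  have hFm : Measurable fun z : ι → ℝ × ℝ =>
      (Real.exp (-c * (pairEnergy K ε z / 2)) * ∏ i, g (z i)).toNNReal := by
    have hG : Measurable fun z : ι → ℝ × ℝ => ∏ i, g (z i) :=
      Finset.measurable_prod _ fun i _ => hgm.comp (measurable_pi_apply i)
    have hE := ((measurable_pairEnergy hKm ε).div_const 2).const_mul (-c)
    exact (hE.exp.mul hG).real_toNNReal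
  have hFU : (Function.support fun z : ι → ℝ × ℝ =>
      (Real.exp (-c * (pairEnergy K ε z / 2)) * ∏ i, g (z i)).toNNReal) ⊆
        univ.pi fun _ => U := by
    intro z hz i _
    refine hgU fun hgi => hz ?_
    have hprod : ∏ j, g (z j) = 0 := Finset.prod_eq_zero (Finset.mem_univ i) hgi
    simp only [hprod, mul_zero, Real.toNNReal_zero]
  rw [chargeIntegral_sumElim_neg _ hKsymm hg0]
  exact sq_lintegral_le_of_quadratic_form_nonneg_of_measurable hU hUfin hKm hK hpos hFm hFU ε hc

end Charges

/-- **Cauchy–Schwarz step.**  Under positivity of `hbar·𝓗₀ + Q` on `D_μ`, for every `n ≥ 1`,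
every sign vector `ε ∈ {±1}^n` and every `δ ∈ {±1}^{2n}` with exactly `n` entries equal to
`+1`, one has `I_n(ε)² ≤ I_{2n}(δ)` in `[0,∞]`. -/
theorem cauchy_schwarz_step (μ hbar a : ℝ) (hμ : 0 < μ) (hhbar : 0 < hbar) (ha : 0 < a)
    (Q : ℝ × ℝ → ℝ × ℝ → ℝ)
    (hQc : Continuous fun z : (ℝ × ℝ) × (ℝ × ℝ) => Q z.1 z.2)
    (hQsymm : ∀ z z', Q z z' = Q z' z) (hQpos : ∀ z z', 0 ≤ Q z z')
    (hpsd : PosSemidefOn μ hbar Q)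
    (g : ℝ × ℝ → ℝ) (hg0 : ∀ z, 0 ≤ g z) (hgb : ∃ M, ∀ z, g z ≤ M)
    (hgm : Measurable g) (hgsupp : Function.support g ⊆ diamond μ) :
    ∀ n : ℕ, 1 ≤ n → ∀ ε : Fin n → ℝ, (∀ i, ε i = 1 ∨ ε i = -1) →
      ∀ δ : Fin (2 * n) → ℝ, (∀ i, δ i = 1 ∨ δ i = -1) →
        (Finset.univ.filter fun i : Fin (2 * n) => δ i = 1).card = n →
        Iint a hbar μ Q g ε ^ 2 ≤ Iint a hbar μ Q g δ := by
  intro n _ ε hε δ hδ hcard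
  set K : ℝ × ℝ → ℝ × ℝ → ℝ := fun x y => hbar * H0 μ (x - y) + Q x y with hKdef
  have hKsymm : ∀ x y, K x y = K y x := fun x y => by
    simp only [hKdef, hQsymm x y, ← neg_sub x y, H0_neg]
  have hIint {k : ℕ} (θ : Fin k → ℝ) :
      Iint a hbar μ Q g θ = chargeIntegral (a ^ 2) K g θ := by
    refine lintegral_congr fun z => ?_
    rw [← sum_lt_eq_half_pairEnergy hKsymm]
  obtain ⟨e, he⟩ : ∃ e : Fin (2 * n) ≃ Fin n ⊕ Fin n, Sum.elim ε (-ε) ∘ e = δ := by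
    refine exists_equiv_comp_eq_of_card_eq hδ ?_ (by simp [two_mul]) ?_
    · rintro (i | i)
      · exact hε i
      · rcases hε i with h | h <;> simp [h]
    · rw [card_sumElim_neg_eq_one hε, Fintype.card_fin, Fintype.card_subtype, hcard]
  have hKm : Measurable fun p : (ℝ × ℝ) × (ℝ × ℝ) => K p.1 p.2 :=
    (((measurable_H0 μ).comp (measurable_fst.sub measurable_snd)).const_mul hbar).add
      hQc.measurable
  rw [hIint, hIint, ← he, chargeIntegral_comp_equiv]
  exact sq_chargeIntegral_le (isOpen_diamond μ).measurableSet
    (isBounded_diamond μ).measure_lt_top.ne hKsymm hKm (integrableOn_kernel μ hbar hQc)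
    (fun f M hf hfM hfU => hpsd.quadratic_form_nonneg hQc hf hfM hfU) hg0 hgm hgsupp ε (sq_nonneg a)
end
end

section
/- (L^p-bound for fractional powers of Cauchy determinants.) Let β ∈ (0,1) and μ > 0. There exists K > 0 such that for every n ≥ 1, ∫_{[−μ,μ]^{4n}} |det(1/(x_i^u − y_j^u))_{i,j}|^{β} · |det(1/(x_i^v − y_j^v))_{i,j}|^{β} ∏_{i=1}^n dx_i^u dx_i^v dy_i^u dy_i^v ≤ (n!)² K^{2n}, the integrand being defined almost everywhere. -/
open MeasureTheory

noncomputable section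

/-- Tonelli's theorem for a product of functions of separate variables. -/
theorem lintegral_fin_prod_eq_prod_lintegral {E : Type*} [MeasurableSpace E] (ν : Measure E)
    [SigmaFinite ν] {n : ℕ} (f : Fin n → E → ENNReal) (hf : ∀ i, Measurable (f i)) :
    ∫⁻ x, ∏ i, f i (x i) ∂(Measure.pi fun _ : Fin n => ν) = ∏ i, ∫⁻ x, f i x ∂ν := by
  induction n with
  | zero => simp
  | succ n ih =>
    rw [← ((measurePreserving_piFinSuccAbove (fun _ : Fin (n + 1) => ν) 0).symm).lintegral_comp_emb
      (MeasurableEquiv.measurableEmbedding _)]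
    simp_rw [MeasurableEquiv.piFinSuccAbove_symm_apply, Fin.insertNthEquiv,
      Fin.prod_univ_succ, Fin.insertNth_zero, Equiv.coe_fn_mk, Fin.cons_succ, Fin.cons_zero]
    rw [← ih (fun i => f i.succ) fun i => hf i.succ]
    refine lintegral_prod_mul (μ := ν) (ν := Measure.pi fun _ : Fin n => ν) (f := f 0)
      (g := fun x : Fin n → E => ∏ i, f i.succ (x i)) (hf 0).aemeasurable ?_
    exact (Finset.measurable_prod _ fun i _ =>
      (hf i.succ).comp (measurable_pi_apply i)).aemeasurable

/-- Subadditivity of `t ↦ t ^ β` applied to the Leibniz expansion of a determinant. -/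
theorem enorm_det_rpow_le {n : ℕ} (M : Matrix (Fin n) (Fin n) ℝ) {β : ℝ} (hβ0 : 0 < β)
    (hβ1 : β ≤ 1) :
    ‖M.det‖ₑ ^ β ≤ ∑ σ : Equiv.Perm (Fin n), ∏ i, ‖M (σ i) i‖ₑ ^ β := by
  have hsub : ∀ s : Finset (Equiv.Perm (Fin n)), ∀ a : Equiv.Perm (Fin n) → ENNReal,
      (∑ σ ∈ s, a σ) ^ β ≤ ∑ σ ∈ s, a σ ^ β := fun s a =>
    Finset.le_sum_of_subadditive (fun t : ENNReal => t ^ β) (ENNReal.zero_rpow_of_pos hβ0).le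
      (fun x y => ENNReal.rpow_add_le_add_rpow x y hβ0.le hβ1) s a
  rw [Matrix.det_apply']
  calc _ ≤ (∑ σ : Equiv.Perm (Fin n), ‖((Equiv.Perm.sign σ : ℤ) : ℝ) * ∏ i, M (σ i) i‖ₑ) ^ β := by
        gcongr
        exact enorm_sum_le _ _
    _ ≤ _ := (hsub _ _).trans_eq <| Finset.sum_congr rfl fun σ _ => by
        have hsign : ‖((Equiv.Perm.sign σ : ℤ) : ℝ)‖ₑ = 1 := by
          rcases Int.units_eq_one_or (Equiv.Perm.sign σ) with h | h <;> simp [h]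
        rw [enorm_mul, hsign, one_mul, ENNReal.prod_rpow_of_nonneg hβ0.le]
        congr 1
        simp [enorm_eq_nnnorm, nnnorm_prod]

theorem lintegral_enorm_inv_rpow_lt_top {β : ℝ} (hβ0 : 0 < β) (hβ1 : β < 1) (R : ℝ) :
    ∫⁻ t in Set.Icc (-R) R, ‖1 / t‖ₑ ^ β < ⊤ := by
  have hint : IntegrableOn (fun t : ℝ => |1 / t| ^ β) (Set.Icc (-R) R) := by
    refine (locallyIntegrable_of_norm_le_rpow (C := 1) (α := β) (by simp) (by simpa using hβ1)
      (Filter.Eventually.of_forall fun t => ?_)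
      (Measurable.aestronglyMeasurable (by fun_prop))).integrableOn_isCompact isCompact_Icc
    rw [one_mul, Real.norm_of_nonneg (by positivity), Real.norm_eq_abs, one_div, abs_inv,
      Real.inv_rpow (abs_nonneg t), Real.rpow_neg (abs_nonneg t)]
  refine lt_of_le_of_lt (le_of_eq (lintegral_congr fun t => ?_)) hint.2
  rw [Real.enorm_eq_ofReal_abs, ENNReal.ofReal_rpow_of_nonneg (abs_nonneg _) hβ0.le,
    Real.enorm_of_nonneg (by positivity)]

theorem lintegral_enorm_inv_sub_rpow_le (β : ℝ) {μ x : ℝ} (hx : x ∈ Set.Icc (-μ) μ) :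
    ∫⁻ y in Set.Icc (-μ) μ, ‖1 / (x - y)‖ₑ ^ β ≤
      ∫⁻ t in Set.Icc (-(2 * μ)) (2 * μ), ‖1 / t‖ₑ ^ β := by
  rw [← lintegral_indicator measurableSet_Icc, ← lintegral_indicator measurableSet_Icc,
    ← lintegral_sub_left_eq_self (Set.indicator (Set.Icc (-(2 * μ)) (2 * μ)) _) x]
  refine lintegral_mono fun y => ?_
  by_cases hy : y ∈ Set.Icc (-μ) μ
  · obtain ⟨h1, h2⟩ := hx
    have hxy : x - y ∈ Set.Icc (-(2 * μ)) (2 * μ) := by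
      constructor <;> linarith [hy.1, hy.2]
    simp [hy, hxy]
  · simp [hy]

theorem lintegral_cauchy_det_rpow_le {n : ℕ} {β μ : ℝ} (hβ0 : 0 < β) (hβ1 : β ≤ 1)
    {x : Fin n → ℝ} (hx : x ∈ Set.univ.pi fun _ => Set.Icc (-μ) μ) :
    ∫⁻ y in Set.univ.pi fun _ => Set.Icc (-μ) μ,
        ‖Matrix.det (Matrix.of fun i j : Fin n => 1 / (x i - y j))‖ₑ ^ β ≤
      n.factorial * (∫⁻ t in Set.Icc (-(2 * μ)) (2 * μ), ‖1 / t‖ₑ ^ β) ^ n := by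
  have hterm : ∀ σ : Equiv.Perm (Fin n),
      ∫⁻ y in Set.univ.pi fun _ => Set.Icc (-μ) μ, ∏ i, ‖1 / (x (σ i) - y i)‖ₑ ^ β ≤
        (∫⁻ t in Set.Icc (-(2 * μ)) (2 * μ), ‖1 / t‖ₑ ^ β) ^ n := fun σ => by
    rw [volume_pi, Measure.restrict_pi_pi, lintegral_fin_prod_eq_prod_lintegral _
      (fun i y => ‖1 / (x (σ i) - y)‖ₑ ^ β) fun i => by fun_prop]
    exact (Finset.prod_le_pow_card _ _ _ fun i _ =>
      lintegral_enorm_inv_sub_rpow_le β (hx (σ i) (Set.mem_univ _))).trans_eq (by simp)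
  refine (lintegral_mono fun y => enorm_det_rpow_le _ hβ0 hβ1).trans ?_
  simp only [Matrix.of_apply]
  rw [lintegral_finsetSum _ fun σ _ => by fun_prop]
  exact (Finset.sum_le_card_nsmul _ _ _ fun σ _ => hterm σ).trans_eq
    (by simp [Fintype.card_perm])

/-- **`L^p`-bound for fractional powers of Cauchy determinants.**
For `β ∈ (0,1)` and `μ > 0` there exists `K > 0` such that for every `n ≥ 1`,
`∫_{[−μ,μ]^{4n}} |det(1/(x_i^u − y_j^u))|^β · |det(1/(x_i^v − y_j^v))|^β ≤ (n!)² K^{2n}`,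
the integrand being defined almost everywhere (Lean's division-by-zero convention takes
care of the null set where some `x_i = y_j`).  In the quadruple `w` below,
`w.1 = x^u`, `w.2.1 = x^v`, `w.2.2.1 = y^u`, `w.2.2.2 = y^v`. -/
theorem Lp_bound_cauchy_determinants (β μ : ℝ) (hβ0 : 0 < β) (hβ1 : β < 1) (hμ : 0 < μ) :
    ∃ K : ℝ, 0 < K ∧ ∀ n : ℕ, 1 ≤ n →
      (∫⁻ w : (Fin n → ℝ) × (Fin n → ℝ) × (Fin n → ℝ) × (Fin n → ℝ) in
          (Set.univ.pi fun _ => Set.Icc (-μ) μ) ×ˢ (Set.univ.pi fun _ => Set.Icc (-μ) μ) ×ˢ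
            (Set.univ.pi fun _ => Set.Icc (-μ) μ) ×ˢ (Set.univ.pi fun _ => Set.Icc (-μ) μ),
        ENNReal.ofReal
          (|Matrix.det (Matrix.of fun i j : Fin n => 1 / (w.1 i - w.2.2.1 j))| ^ β *
            |Matrix.det (Matrix.of fun i j : Fin n => 1 / (w.2.1 i - w.2.2.2 j))| ^ β)) ≤
      ENNReal.ofReal ((n.factorial : ℝ) ^ 2 * K ^ (2 * n)) := by
  set C : ENNReal := ∫⁻ t in Set.Icc (-(2 * μ)) (2 * μ), ‖1 / t‖ₑ ^ β with hC
  have hCtop : C ≠ ⊤ := (lintegral_enorm_inv_rpow_lt_top hβ0 hβ1 _).ne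
  refine ⟨2 * μ * (C.toReal + 1), by positivity, fun n _ => ?_⟩
  set S : Set (Fin n → ℝ) := Set.univ.pi fun _ => Set.Icc (-μ) μ with hS
  have hSm : MeasurableSet S := MeasurableSet.univ_pi fun _ => measurableSet_Icc
  have hSvol : volume S = ENNReal.ofReal (2 * μ) ^ n := by
    rw [hS, volume_pi_pi]
    simp [two_mul]
  have hdet : ∀ x ∈ S, ∫⁻ y in S,
      ‖Matrix.det (Matrix.of fun i j : Fin n => 1 / (x i - y j))‖ₑ ^ β ≤ n.factorial * C ^ n :=
    fun x hx => lintegral_cauchy_det_rpow_le hβ0 hβ1.le hx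
  set F : (Fin n → ℝ) → (Fin n → ℝ) → ENNReal := fun x y =>
    ‖Matrix.det (Matrix.of fun i j : Fin n => 1 / (x i - y j))‖ₑ ^ β with hF
  have hFtop : ∀ x y, F x y ≠ ⊤ := fun x y => ENNReal.rpow_ne_top_of_nonneg hβ0.le enorm_ne_top
  calc _ = ∫⁻ w in S ×ˢ S ×ˢ S ×ˢ S, F w.1 w.2.2.1 * F w.2.1 w.2.2.2 := by
        refine lintegral_congr fun w => ?_
        rw [ENNReal.ofReal_mul (by positivity), ← ENNReal.ofReal_rpow_of_nonneg (abs_nonneg _) hβ0.le,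
          ← ENNReal.ofReal_rpow_of_nonneg (abs_nonneg _) hβ0.le, ← Real.enorm_eq_ofReal_abs,
          ← Real.enorm_eq_ofReal_abs]
    _ ≤ ∫⁻ a in S, ∫⁻ b in S, ∫⁻ c in S, ∫⁻ d in S, F a c * F b d := by
        simp only [Measure.volume_eq_prod, ← Measure.prod_restrict]
        refine (lintegral_prod_le _).trans (lintegral_mono fun a => ?_)
        refine (lintegral_prod_le _).trans (lintegral_mono fun b => ?_)
        exact lintegral_prod_le _
    _ ≤ ∫⁻ a in S, ∫⁻ b in S, (n.factorial * C ^ n) * (n.factorial * C ^ n) := by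
        refine setLIntegral_mono' hSm fun a ha => setLIntegral_mono' hSm fun b hb => ?_
        simp_rw [lintegral_const_mul' _ _ (hFtop _ _)]
        rw [lintegral_mul_const']
        · exact mul_le_mul' (hdet a ha) (hdet b hb)
        · exact ne_top_of_le_ne_top (by finiteness) (hdet b hb)
    _ = n.factorial ^ 2 * (ENNReal.ofReal (2 * μ) * C) ^ (2 * n) := by
        simp only [lintegral_const, Measure.restrict_apply_univ, hSvol]
        ring
    _ ≤ n.factorial ^ 2 * (ENNReal.ofReal (2 * μ) * ENNReal.ofReal (C.toReal + 1)) ^ (2 * n) := by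
        gcongr
        exact ENNReal.le_ofReal_iff_toReal_le hCtop (by positivity) |>.2 (by linarith)
    _ = _ := by
        rw [← ENNReal.ofReal_mul (by positivity), ← ENNReal.ofReal_pow (by positivity),
          ← ENNReal.ofReal_natCast, ← ENNReal.ofReal_pow (by positivity),
          ENNReal.ofReal_mul (by positivity)]
end
end
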